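/- Let f be a WG-drawing of a finite simple graph G with witness set P ⊆ ℝ² such that every point of the image of f has strictly positive y-coordinate and every point of P has strictly negative y-coordinate. Let u, v be adjacent vertices of G with x(f(u)) < x(f(v)), and let z be a vertex of G distinct from u and v such that x(f(u)) ≤ x(f(z)) ≤ x(f(v)) and f(z) lies on or above the line through f(u) and f(v) (i.e. f(z) lies in the closed far half-strip S_F[u,v]). Then z is adjacent to u and z is adjacent to v in G. -/

import Mathlib

noncomputable section

/-- The Euclidean plane. -/
abbrev Pt : Type := EuclideanSpace ℝ (Fin 2)

/-- The Gabriel disk `D[u,v]`: the closed disk having `u` and `v` as antipodal points. -/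
def gabrielDisk (u v : Pt) : Set Pt := Metric.closedBall (midpoint ℝ u v) (dist u v / 2)

/-- `f` is a witness Gabriel drawing of the finite simple graph `G` with witness set `P`. -/
def IsWGDrawing {V : Type*} [Fintype V] (G : SimpleGraph V) (f : V → Pt) (P : Set Pt) : Prop :=
  Function.Injective f ∧ Disjoint (Set.range f) P ∧
    ∀ u v : V, u ≠ v → (G.Adj u v ↔ gabrielDisk (f u) (f v) ∩ P = ∅)

/-- `⟨f₀, f₁⟩` is a mutual witness Gabriel drawing of the pair `⟨G₀, G₁⟩`. -/
def IsMWGDrawing {V₀ V₁ : Type*} [Fintype V₀] [Fintype V₁]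
    (G₀ : SimpleGraph V₀) (G₁ : SimpleGraph V₁) (f₀ : V₀ → Pt) (f₁ : V₁ → Pt) : Prop :=
  Function.Injective f₀ ∧ Function.Injective f₁ ∧
    Disjoint (Set.range f₀) (Set.range f₁) ∧
    (∀ u v : V₀, u ≠ v → (G₀.Adj u v ↔ gabrielDisk (f₀ u) (f₀ v) ∩ Set.range f₁ = ∅)) ∧
    (∀ u v : V₁, u ≠ v → (G₁.Adj u v ↔ gabrielDisk (f₁ u) (f₁ v) ∩ Set.range f₀ = ∅))

/-- Two subsets of the plane are linearly separable. -/
def LinSep (A B : Set Pt) : Prop :=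
  ∃ (φ : Pt →ₗ[ℝ] ℝ) (c : ℝ), φ ≠ 0 ∧ (∀ a ∈ A, φ a < c) ∧ ∀ b ∈ B, c < φ b

theorem mem_gabrielDisk_iff (u v p : Pt) :
    p ∈ gabrielDisk u v ↔
      (u 0 - p 0) * (v 0 - p 0) + (u 1 - p 1) * (v 1 - p 1) ≤ 0 := by
  have hm : ∀ i, midpoint ℝ u v i = (u i + v i) / 2 := fun i => by
    simp [midpoint_eq_smul_add]; ring
  rw [gabrielDisk, Metric.mem_closedBall, ← sq_le_sq₀ dist_nonneg (by positivity), div_pow,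
    EuclideanSpace.dist_sq_eq, EuclideanSpace.dist_sq_eq]
  simp only [Fin.sum_univ_two, Real.dist_eq, sq_abs, hm]
  constructor <;> intro h <;> linarith

/-- If the point `(c, d)` is seen from the origin at a non-acute angle with `(a, b)`, so is any
point `(e, g)` to its right lying on or below the line through `(a, b)` and `(c, d)`. -/
theorem dot_nonpos_of_below_line {a b c d e g : ℝ} (hb : 0 < b) (hd : 0 < d)
    (hac : a ≤ c) (hce : c ≤ e) (habove : (e - a) * (d - b) ≥ (g - b) * (c - a))
    (h : a * c + b * d ≤ 0) : a * e + b * g ≤ 0 := by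
  have hbd : 0 < b * d := mul_pos hb hd
  have hlt : a < c := lt_of_le_of_ne hac fun hEq => by
    subst hEq
    nlinarith [mul_self_nonneg a]
  have key : (c - a) * (a * e + b * g) ≤ 0 := by
    nlinarith [mul_le_mul_of_nonneg_left habove hb.le,
      mul_nonneg (sub_nonneg.2 (hac.trans hce)) (neg_nonneg.2 h),
      mul_nonneg (sub_nonneg.2 hce) (sq_nonneg a), mul_nonneg (sub_nonneg.2 hce) (sq_nonneg b)]
  exact nonpos_of_mul_nonpos_right key (sub_pos.2 hlt)

/-- Lemma 6: if `uv` is an edge of a linearly separated WG-drawing and `z` lies in the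
closed far half-strip of `u, v`, then `z` is adjacent to both `u` and `v`. -/
theorem stmt11 {V : Type*} [Fintype V] (G : SimpleGraph V) (f : V → Pt) (P : Set Pt)
    (hWG : IsWGDrawing G f P)
    (hy : ∀ v, 0 < f v 1) (hP : ∀ p ∈ P, p 1 < 0)
    (u v : V) (hadj : G.Adj u v) (hx : f u 0 < f v 0)
    (z : V) (hzu : z ≠ u) (hzv : z ≠ v)
    (hx₁ : f u 0 ≤ f z 0) (hx₂ : f z 0 ≤ f v 0)
    (habove : (f v 0 - f u 0) * (f z 1 - f u 1) ≥ (f v 1 - f u 1) * (f z 0 - f u 0)) :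
    G.Adj z u ∧ G.Adj z v := by
  obtain ⟨-, -, hG⟩ := hWG
  have hempty := Set.eq_empty_iff_forall_notMem.1 ((hG u v hadj.ne).1 hadj)
  refine ⟨(hG z u hzu).2 (Set.eq_empty_iff_forall_notMem.2 fun p hp => hempty p ⟨?_, hp.2⟩),
    (hG z v hzv).2 (Set.eq_empty_iff_forall_notMem.2 fun p hp => hempty p ⟨?_, hp.2⟩)⟩
  all_goals
    have h := (mem_gabrielDisk_iff _ _ _).1 hp.1
    have hp1 := hP p hp.2
    have hu := hy u
    have hv := hy v
    have hz := hy z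
    rw [mem_gabrielDisk_iff]
  · exact dot_nonpos_of_below_line (c := f z 0 - p 0) (d := f z 1 - p 1)
      (by linarith) (by linarith) (by linarith) (by linarith) (by linarith) (by linarith)
  · have := dot_nonpos_of_below_line (a := p 0 - f v 0) (b := f v 1 - p 1)
      (c := p 0 - f z 0) (d := f z 1 - p 1) (e := p 0 - f u 0) (g := f u 1 - p 1)
      (by linarith) (by linarith) (by linarith) (by linarith) (by linarith) (by linarith)
    linarith
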